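/- On ℝ^5 with coordinates (a_1,a_2,b_1,b_2,b_3), the bracket {f,g}_1 defined by the quadratic (Adler) matrix Π_1 satisfies the Jacobi identity for all smooth f, g, h : ℝ^5 → ℝ (so Π_1 is a Poisson tensor), and the function f_2 = b_1b_2b_3 − b_1a_2² − b_3a_1² is a Casimir of {·,·}_1: {f_2, g}_1 vanishes identically for every smooth g : ℝ^5 → ℝ. -/

import Mathlib

open Matrix

/-- The bracket `{f,g}_Π(p) = Σ_{i,j} Π(p)_{ij} ∂f/∂u_i(p) ∂g/∂u_j(p)` on `ℝ^n` associated
to a matrix-valued function `P`. -/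
noncomputable def mbracket {n : ℕ} (P : (Fin n → ℝ) → Matrix (Fin n) (Fin n) ℝ)
    (f g : (Fin n → ℝ) → ℝ) (p : Fin n → ℝ) : ℝ :=
  ∑ i, ∑ j, P p i j * fderiv ℝ f p (Pi.single i 1) * fderiv ℝ g p (Pi.single j 1)

/-- The `i`-th component of the Hamiltonian vector field of `h` with respect to `P`. -/
noncomputable def hamVF {n : ℕ} (P : (Fin n → ℝ) → Matrix (Fin n) (Fin n) ℝ)
    (h : (Fin n → ℝ) → ℝ) (p : Fin n → ℝ) (i : Fin n) : ℝ :=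
  ∑ j, P p i j * fderiv ℝ h p (Pi.single j 1)

/-- The linear Toda Poisson tensor `Π_0` on `ℝ^5`, in Flaschka coordinates
`(a_1,a_2,b_1,b_2,b_3) = (p 0, …, p 4)`. -/
noncomputable def TPi0 (p : Fin 5 → ℝ) : Matrix (Fin 5) (Fin 5) ℝ :=
  !![0,     0,    -p 0,  p 0,   0;
     0,     0,    0,     -p 1,  p 1;
     p 0,   0,    0,     0,     0;
     -p 0,  p 1,  0,     0,     0;
     0,     -p 1, 0,     0,     0]

/-- The quadratic (Adler) Toda Poisson tensor `Π_1` on `ℝ^5`. -/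
noncomputable def TPi1 (p : Fin 5 → ℝ) : Matrix (Fin 5) (Fin 5) ℝ :=
  !![0,              p 0 * p 1 / 2,  -p 0 * p 2,   p 0 * p 3,    0;
     -p 0 * p 1 / 2, 0,              0,            -p 1 * p 3,   p 1 * p 4;
     p 0 * p 2,      0,              0,            2 * p 0 ^ 2,  0;
     -p 0 * p 3,     p 1 * p 3,      -2 * p 0 ^ 2, 0,            2 * p 1 ^ 2;
     0,              -p 1 * p 4,     0,            -2 * p 1 ^ 2, 0]

lemma clm_apply_eq_sum_single {n : ℕ} (L : (Fin n → ℝ) →L[ℝ] ℝ) (w : Fin n → ℝ) :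
    L w = ∑ i, w i * L (Pi.single i 1) := by
  conv_lhs => rw [pi_eq_sum_univ' w]
  simp [Pi.single]

/-- In terms of the vector field `df ᵥ* P`, the bracket `{f, g}` is a directional derivative. -/
lemma mbracket_eq_fderiv_vecMul {n : ℕ} (P : (Fin n → ℝ) → Matrix (Fin n) (Fin n) ℝ)
    (f g : (Fin n → ℝ) → ℝ) (p : Fin n → ℝ) :
    mbracket P f g p
      = fderiv ℝ g p ((fun i => fderiv ℝ f p (Pi.single i 1)) ᵥ* P p) := by
  rw [clm_apply_eq_sum_single]
  simp only [mbracket, vecMul, dotProduct, Finset.sum_mul]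
  rw [Finset.sum_comm]
  simp only [mul_comm (P p _ _)]

/-- The Leibniz rule for the derivative of a bracket; the second-order terms are expressed through
the vector fields of `f` and `g`. -/
lemma fderiv_mbracket {n : ℕ} {P : (Fin n → ℝ) → Matrix (Fin n) (Fin n) ℝ}
    {f g : (Fin n → ℝ) → ℝ} {p : Fin n → ℝ}
    (hP : ∀ i j, DifferentiableAt ℝ (fun q => P q i j) p) (hskew : (P p)ᵀ = -P p)
    (hf : DifferentiableAt ℝ (fderiv ℝ f) p) (hg : DifferentiableAt ℝ (fderiv ℝ g) p)
    (v : Fin n → ℝ) :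
    fderiv ℝ (mbracket P f g) p v
      = ∑ i, ∑ j, fderiv ℝ (fun q => P q i j) p v
            * fderiv ℝ f p (Pi.single i 1) * fderiv ℝ g p (Pi.single j 1)
        - fderiv ℝ (fderiv ℝ f) p v ((fun i => fderiv ℝ g p (Pi.single i 1)) ᵥ* P p)
        + fderiv ℝ (fderiv ℝ g) p v ((fun i => fderiv ℝ f p (Pi.single i 1)) ᵥ* P p) := by
  have hf' (w : Fin n → ℝ) : HasFDerivAt (fun q => fderiv ℝ f q w)
      ((fderiv ℝ (fderiv ℝ f) p).flip w) p := by
    simpa using hf.hasFDerivAt.clm_apply (hasFDerivAt_const w p)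
  have hg' (w : Fin n → ℝ) : HasFDerivAt (fun q => fderiv ℝ g q w)
      ((fderiv ℝ (fderiv ℝ g) p).flip w) p := by
    simpa using hg.hasFDerivAt.clm_apply (hasFDerivAt_const w p)
  have hB := HasFDerivAt.fun_sum (u := Finset.univ) fun i _ =>
    HasFDerivAt.fun_sum (u := Finset.univ) fun j _ =>
      (((hP i j).hasFDerivAt.fun_mul (hf' (Pi.single i 1))).fun_mul (hg' (Pi.single j 1)))
  have hskew' (i j : Fin n) : P p j i = -P p i j := congrFun (congrFun hskew i) j
  rw [hB.fderiv (f := mbracket P f g), clm_apply_eq_sum_single (fderiv ℝ (fderiv ℝ f) p v),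
    clm_apply_eq_sum_single (fderiv ℝ (fderiv ℝ g) p v)]
  simp only [vecMul, dotProduct, Finset.sum_mul]
  rw [Finset.sum_comm (γ := Fin n) (f := fun i j => fderiv ℝ f p (Pi.single j 1) * P p j i * _)]
  simp only [← Finset.sum_sub_distrib, ← Finset.sum_add_distrib, _root_.sum_apply]
  refine Finset.sum_congr rfl fun i _ => Finset.sum_congr rfl fun j _ => ?_
  simp [hskew' i j]
  ring

/-- A skew-symmetric matrix of functions whose Schouten bracket with itself vanishes defines a
bracket satisfying the Jacobi identity. -/
lemma mbracket_jacobi {n : ℕ} {P : (Fin n → ℝ) → Matrix (Fin n) (Fin n) ℝ} {p : Fin n → ℝ}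
    (hP : ∀ i j, DifferentiableAt ℝ (fun q => P q i j) p) (hskew : (P p)ᵀ = -P p)
    (hschouten : ∀ x y z : Fin n → ℝ,
      ∑ i, ∑ j, fderiv ℝ (fun q => P q i j) p (x ᵥ* P p) * y i * z j
        + ∑ i, ∑ j, fderiv ℝ (fun q => P q i j) p (y ᵥ* P p) * z i * x j
        + ∑ i, ∑ j, fderiv ℝ (fun q => P q i j) p (z ᵥ* P p) * x i * y j = 0)
    {f g h : (Fin n → ℝ) → ℝ} (hf : ContDiffAt ℝ 2 f p) (hg : ContDiffAt ℝ 2 g p)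
    (hh : ContDiffAt ℝ 2 h p) :
    mbracket P f (mbracket P g h) p + mbracket P g (mbracket P h f) p
      + mbracket P h (mbracket P f g) p = 0 := by
  have hd {φ : (Fin n → ℝ) → ℝ} (hφ : ContDiffAt ℝ 2 φ p) : DifferentiableAt ℝ (fderiv ℝ φ) p :=
    (hφ.fderiv_right (m := 1) (by norm_num)).differentiableAt (by norm_num)
  have hs {φ : (Fin n → ℝ) → ℝ} (hφ : ContDiffAt ℝ 2 φ p) : IsSymmSndFDerivAt ℝ φ p :=
    hφ.isSymmSndFDerivAt (by simp)
  simp only [mbracket_eq_fderiv_vecMul P _ (mbracket P _ _)]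
  rw [fderiv_mbracket hP hskew (hd hg) (hd hh), fderiv_mbracket hP hskew (hd hh) (hd hf),
    fderiv_mbracket hP hskew (hd hf) (hd hg)]
  have key := hschouten (fun i => fderiv ℝ f p (Pi.single i 1))
    (fun i => fderiv ℝ g p (Pi.single i 1)) (fun i => fderiv ℝ h p (Pi.single i 1))
  set X := (fun i => fderiv ℝ f p (Pi.single i 1)) ᵥ* P p
  set Y := (fun i => fderiv ℝ g p (Pi.single i 1)) ᵥ* P p
  set Z := (fun i => fderiv ℝ h p (Pi.single i 1)) ᵥ* P p
  linarith [(hs hf).eq Y Z, (hs hg).eq Z X, (hs hh).eq X Y]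

lemma transpose_TPi1 (p : Fin 5 → ℝ) : (TPi1 p)ᵀ = -TPi1 p := by
  ext i j
  fin_cases i <;> fin_cases j <;> simp [TPi1, neg_div]

lemma differentiable_TPi1_apply (i j : Fin 5) : Differentiable ℝ fun q => TPi1 q i j := by
  fin_cases i <;> fin_cases j <;> simp [TPi1] <;> fun_prop

/-- Since `TPi1` is homogeneous quadratic, its derivative is its polarization. -/
lemma fderiv_TPi1_apply (p v : Fin 5 → ℝ) (i j : Fin 5) :
    fderiv ℝ (fun q => TPi1 q i j) p v = TPi1 (p + v) i j - TPi1 p i j - TPi1 v i j := by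
  have hexp (t : ℝ) : TPi1 (p + t • v) i j
      = TPi1 p i j + t * (TPi1 (p + v) i j - TPi1 p i j - TPi1 v i j) + t ^ 2 * TPi1 v i j := by
    fin_cases i <;> fin_cases j <;> simp [TPi1] <;> ring
  have hpoly : HasDerivAt (fun t : ℝ => TPi1 (p + t • v) i j)
      (TPi1 (p + v) i j - TPi1 p i j - TPi1 v i j) 0 := by
    simp only [hexp]
    simpa using (((hasDerivAt_id (0 : ℝ)).mul_const
      (TPi1 (p + v) i j - TPi1 p i j - TPi1 v i j)).const_add (TPi1 p i j)).fun_add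
        (((hasDerivAt_id (0 : ℝ)).fun_pow 2).mul_const (TPi1 v i j))
  rw [← (differentiable_TPi1_apply i j p).lineDeriv_eq_fderiv]
  exact hpoly.deriv

/-- The bracket defined by the quadratic (Adler) Toda tensor `Π_1`
satisfies the Jacobi identity (so `Π_1` is a Poisson tensor), and
`f_2 = b_1b_2b_3 − b_1a_2² − b_3a_1²` is a Casimir. -/
theorem TPi1_Jacobi_and_Casimir :
    (∀ f g h : (Fin 5 → ℝ) → ℝ, ContDiff ℝ (⊤ : ℕ∞) f → ContDiff ℝ (⊤ : ℕ∞) g → ContDiff ℝ (⊤ : ℕ∞) h →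
      ∀ p : Fin 5 → ℝ,
        mbracket TPi1 f (mbracket TPi1 g h) p + mbracket TPi1 g (mbracket TPi1 h f) p
          + mbracket TPi1 h (mbracket TPi1 f g) p = 0) ∧
    (∀ g : (Fin 5 → ℝ) → ℝ, ContDiff ℝ (⊤ : ℕ∞) g →
      ∀ p : Fin 5 → ℝ,
        mbracket TPi1 (fun q => q 2 * q 3 * q 4 - q 2 * q 1 ^ 2 - q 4 * q 0 ^ 2) g p = 0) := by
  refine ⟨fun f g h hf hg hh p => ?_, fun g _ p => ?_⟩
  · have h2 {φ : (Fin 5 → ℝ) → ℝ} (hφ : ContDiff ℝ (⊤ : ℕ∞) φ) : ContDiffAt ℝ 2 φ p :=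
      (contDiff_infty.1 hφ 2).contDiffAt
    refine mbracket_jacobi (fun i j => differentiable_TPi1_apply i j p) (transpose_TPi1 p)
      (fun x y z => ?_) (h2 hf) (h2 hg) (h2 hh)
    have hsum (v y z : Fin 5 → ℝ) :
        ∑ i, ∑ j, fderiv ℝ (fun q => TPi1 q i j) p v * y i * z j
          = (v 0 * p 1 + p 0 * v 1) / 2 * (y 0 * z 1 - y 1 * z 0)
            - (v 0 * p 2 + p 0 * v 2) * (y 0 * z 2 - y 2 * z 0)
            + (v 0 * p 3 + p 0 * v 3) * (y 0 * z 3 - y 3 * z 0)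
            - (v 1 * p 3 + p 1 * v 3) * (y 1 * z 3 - y 3 * z 1)
            + (v 1 * p 4 + p 1 * v 4) * (y 1 * z 4 - y 4 * z 1)
            + 4 * p 0 * v 0 * (y 2 * z 3 - y 3 * z 2)
            + 4 * p 1 * v 1 * (y 3 * z 4 - y 4 * z 3) := by
      simp only [fderiv_TPi1_apply]
      simp [Fin.sum_univ_five, TPi1]
      ring
    simp only [hsum]
    simp [Fin.sum_univ_five, vecMul, dotProduct, TPi1]
    ring
  · have hF (v : Fin 5 → ℝ) :
        fderiv ℝ (fun q : Fin 5 → ℝ => q 2 * q 3 * q 4 - q 2 * q 1 ^ 2 - q 4 * q 0 ^ 2) p v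
          = v 2 * p 3 * p 4 + p 2 * v 3 * p 4 + p 2 * p 3 * v 4
            - v 2 * p 1 ^ 2 - 2 * p 2 * p 1 * v 1 - v 4 * p 0 ^ 2 - 2 * p 4 * p 0 * v 0 := by
      have e (k : Fin 5) : HasFDerivAt (fun q : Fin 5 → ℝ => q k)
          (ContinuousLinearMap.proj (R := ℝ) k) p := hasFDerivAt_apply k p
      rw [((((e 2).fun_mul (e 3)).fun_mul (e 4)).fun_sub ((e 2).fun_mul ((e 1).pow 2))
        |>.fun_sub ((e 4).fun_mul ((e 0).pow 2))).fderiv]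
      simp
      ring
    simp only [mbracket, hF]
    simp [Fin.sum_univ_five, TPi1, Pi.single_apply]
    ring
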